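/- Appendix theorem on pessimistic equilibria: Suppose n ≥ 2 and Assumptions 1 and 2 hold. Every pure pessimistic Nash equilibrium ((π_1,…,π_n), D) is fully informative, i.e., for every sender j with D(π_1,…,π_n)(j) > 0, the signal π_j is fully informative. -/

import Mathlib

open Finset

namespace Persuasion

variable {n : ℕ} {A ΩR : Type} {Ω : Fin n → Type}
variable [Fintype A] [Fintype ΩR] [∀ k, Fintype (Ω k)]
variable [DecidableEq ΩR] [∀ k, DecidableEq (Ω k)]

/-- A signal for sender `k`: a map from `k`'s and the receiver's states to
distributions over messages/actions. -/
def IsSignal {k : Fin n} (π : Ω k × ΩR → A → ℝ) : Prop :=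
  (∀ s a, 0 ≤ π s a) ∧ ∀ s, ∑ a, π s a = 1

/-- The joint distribution on `Ω × A` induced by the prior `μ0` and sender `k`'s signal `π`. -/
def jointP (μ0 : ((∀ k, Ω k) × ΩR) → ℝ) {k : Fin n}
    (π : Ω k × ΩR → A → ℝ) (ω : (∀ k, Ω k) × ΩR) (a : A) : ℝ :=
  μ0 ω * π (ω.1 k, ω.2) a

/-- The probability that the signal `π` is realized as the message `a`. -/
def Pmsg (μ0 : ((∀ k, Ω k) × ΩR) → ℝ) {k : Fin n}
    (π : Ω k × ΩR → A → ℝ) (a : A) : ℝ :=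
  ∑ ω, jointP μ0 π ω a

/-- The joint probability that `(ω_i, ω_R) = (ωi, ωR)` and the message is `a`. -/
def margIR (μ0 : ((∀ k, Ω k) × ΩR) → ℝ) {k : Fin n}
    (π : Ω k × ΩR → A → ℝ) (i : Fin n) (ωi : Ω i) (ωR : ΩR) (a : A) : ℝ :=
  ∑ ω ∈ univ.filter (fun ω : (∀ k, Ω k) × ΩR => ω.1 i = ωi ∧ ω.2 = ωR), jointP μ0 π ω a

/-- The joint probability that `ω_i = ωi` and the message is `a`. -/
def margI (μ0 : ((∀ k, Ω k) × ΩR) → ℝ) {k : Fin n}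
    (π : Ω k × ΩR → A → ℝ) (i : Fin n) (ωi : Ω i) (a : A) : ℝ :=
  ∑ ω ∈ univ.filter (fun ω : (∀ k, Ω k) × ΩR => ω.1 i = ωi), jointP μ0 π ω a

/-- The joint probability that `ω_R = ωR` and the message is `a`. -/
def margR (μ0 : ((∀ k, Ω k) × ΩR) → ℝ) {k : Fin n}
    (π : Ω k × ΩR → A → ℝ) (ωR : ΩR) (a : A) : ℝ :=
  ∑ ω ∈ univ.filter (fun ω : (∀ k, Ω k) × ΩR => ω.2 = ωR), jointP μ0 π ω a

/-- The posterior probability of `(ω_i, ω_R) = (ωi, ωR)` given that the message is `a`. -/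
noncomputable def posterior (μ0 : ((∀ k, Ω k) × ΩR) → ℝ) {k : Fin n}
    (π : Ω k × ΩR → A → ℝ) (i : Fin n) (ωi : Ω i) (ωR : ΩR) (a : A) : ℝ :=
  margIR μ0 π i ωi ωR a / Pmsg μ0 π a

/-- `E[u_R(b, ω_R) | π = a]`. -/
noncomputable def condExpR (μ0 : ((∀ k, Ω k) × ΩR) → ℝ) {k : Fin n}
    (π : Ω k × ΩR → A → ℝ) (uR : A → ΩR → ℝ) (a b : A) : ℝ :=
  (∑ ω, jointP μ0 π ω a * uR b ω.2) / Pmsg μ0 π a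

/-- Incentive compatibility: each realized message `a` is an optimal action for the
receiver given the posterior it induces. -/
def IC (μ0 : ((∀ k, Ω k) × ΩR) → ℝ) {k : Fin n}
    (π : Ω k × ΩR → A → ℝ) (uR : A → ΩR → ℝ) : Prop :=
  ∀ a, 0 < Pmsg μ0 π a → ∀ b, condExpR μ0 π uR a b ≤ condExpR μ0 π uR a a

/-- The receiver's expected utility `E[u_R(a, ω_R)]` from following the signal `π`. -/
def vR (μ0 : ((∀ k, Ω k) × ΩR) → ℝ) {k : Fin n}
    (π : Ω k × ΩR → A → ℝ) (uR : A → ΩR → ℝ) : ℝ :=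
  ∑ a, ∑ ω, jointP μ0 π ω a * uR a ω.2

/-- Sender `i`'s expected utility `E[u_i(a, ω_i)]` when the receiver follows signal `π`
(of sender `k`). -/
def vS (μ0 : ((∀ k, Ω k) × ΩR) → ℝ) {k : Fin n}
    (π : Ω k × ΩR → A → ℝ) (i : Fin n) (ui : A → Ω i → ℝ) : ℝ :=
  ∑ a, ∑ ω, jointP μ0 π ω a * ui a (ω.1 i)

/-- The set of maximizers of `u` over `A`. -/
noncomputable def argmaxSet (u : A → ℝ) : Finset A :=
  univ.filter (fun a => ∀ b, u b ≤ u a)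

/-- A signal is fully informative if any realized message `a`, in any receiver state `ωR`
that has positive probability jointly with `a`, is the receiver's unique optimal action. -/
noncomputable def FullyInformative (μ0 : ((∀ k, Ω k) × ΩR) → ℝ) {k : Fin n}
    (π : Ω k × ΩR → A → ℝ) (uR : A → ΩR → ℝ) : Prop :=
  ∀ a ωR, 0 < margR μ0 π ωR a → argmaxSet (fun b => uR b ωR) = {a}

/-- Assumption 1: every player has a unique optimal action in each of his states. -/
noncomputable def Assumption1 (uR : A → ΩR → ℝ) (u : ∀ k : Fin n, A → Ω k → ℝ) : Prop :=
  (∀ ωR, (argmaxSet (fun a => uR a ωR)).card = 1) ∧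
  ∀ (k : Fin n) (ωk : Ω k), (argmaxSet (fun a => u k a ωk)).card = 1

/-- Assumption 2: conditional on any positive-probability `(ω_j, ω_R)`, any other sender `i`
has, with positive probability, a state in which his preferences agree with the receiver's. -/
noncomputable def Assumption2 (μ0 : ((∀ k, Ω k) × ΩR) → ℝ) (uR : A → ΩR → ℝ)
    (u : ∀ k : Fin n, A → Ω k → ℝ) : Prop :=
  ∀ i j : Fin n, i ≠ j → ∀ (ωj : Ω j) (ωR : ΩR),
    (0 < ∑ ω ∈ univ.filter (fun ω : (∀ k, Ω k) × ΩR => ω.1 j = ωj ∧ ω.2 = ωR), μ0 ω) →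
    ∃ ωi : Ω i,
      (0 < ∑ ω ∈ univ.filter
        (fun ω : (∀ k, Ω k) × ΩR => ω.1 i = ωi ∧ ω.1 j = ωj ∧ ω.2 = ωR), μ0 ω) ∧
      argmaxSet (fun a => u i a ωi) = argmaxSet (fun a => uR a ωR)

/-- `E_{μ0}[max_{a ∈ A} u_R(a, ω_R)]`: the receiver's first-best expected utility. -/
noncomputable def Emax [Nonempty A] (μ0 : ((∀ k, Ω k) × ΩR) → ℝ) (uR : A → ΩR → ℝ) : ℝ :=
  ∑ ω : (∀ k, Ω k) × ΩR, μ0 ω * univ.sup' univ_nonempty (fun a => uR a ω.2)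

/-- The set of senders whose signals the receiver weakly prefers to all others. -/
noncomputable def BestSet (μ0 : ((∀ k, Ω k) × ΩR) → ℝ)
    (π : ∀ k : Fin n, Ω k × ΩR → A → ℝ) (uR : A → ΩR → ℝ) : Finset (Fin n) :=
  univ.filter (fun j => ∀ k, vR μ0 (π k) uR ≤ vR μ0 (π j) uR)

/-- Sender `i`'s expected payoff under the uniform tie-breaking decision rule. -/
noncomputable def senderPayoff (μ0 : ((∀ k, Ω k) × ΩR) → ℝ)
    (π : ∀ k : Fin n, Ω k × ΩR → A → ℝ) (uR : A → ΩR → ℝ)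
    (i : Fin n) (ui : A → Ω i → ℝ) : ℝ :=
  (∑ j ∈ BestSet μ0 π uR, vS μ0 (π j) i ui) / (BestSet μ0 π uR).card

/-- A pure Nash equilibrium of the persuasion game with the uniform tie-breaking rule. -/
noncomputable def PureNE (μ0 : ((∀ k, Ω k) × ΩR) → ℝ)
    (π : ∀ k : Fin n, Ω k × ΩR → A → ℝ) (uR : A → ΩR → ℝ)
    (u : ∀ k : Fin n, A → Ω k → ℝ) : Prop :=
  (∀ k, IsSignal (π k) ∧ IC μ0 (π k) uR) ∧
  ∀ (i : Fin n) (π' : Ω i × ΩR → A → ℝ), IsSignal π' → IC μ0 π' uR →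
    senderPayoff μ0 (Function.update π i π') uR i (u i) ≤ senderPayoff μ0 π uR i (u i)


/-- An optimal decision rule: for each profile of IC signals, a distribution over senders
supported on senders whose signals the receiver weakly prefers to all others. -/
def IsOptimalRule (μ0 : ((∀ k, Ω k) × ΩR) → ℝ) (uR : A → ΩR → ℝ)
    (D : (∀ k : Fin n, Ω k × ΩR → A → ℝ) → Fin n → ℝ) : Prop :=
  ∀ π : ∀ k : Fin n, Ω k × ΩR → A → ℝ,
    (∀ k, IsSignal (π k) ∧ IC μ0 (π k) uR) →
    (∀ j, 0 ≤ D π j) ∧ (∑ j, D π j = 1) ∧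
    ∀ i, 0 < D π i → ∀ j, vR μ0 (π j) uR ≤ vR μ0 (π i) uR

/-- Sender `i`'s expected payoff from profile `π` under decision rule `D`. -/
def payoffUnder (μ0 : ((∀ k, Ω k) × ΩR) → ℝ)
    (D : (∀ k : Fin n, Ω k × ΩR → A → ℝ) → Fin n → ℝ)
    (π : ∀ k : Fin n, Ω k × ΩR → A → ℝ) (i : Fin n) (ui : A → Ω i → ℝ) : ℝ :=
  ∑ j, D π j * vS μ0 (π j) i ui

/-- A pure pessimistic Nash equilibrium: a profile of IC signals together with an optimal
decision rule `D` such that every unilateral IC deviation of a sender is unprofitable under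
*some* optimal decision rule after the deviation. -/
def PessimisticNE (μ0 : ((∀ k, Ω k) × ΩR) → ℝ)
    (π : ∀ k : Fin n, Ω k × ΩR → A → ℝ) (uR : A → ΩR → ℝ)
    (u : ∀ k : Fin n, A → Ω k → ℝ)
    (D : (∀ k : Fin n, Ω k × ΩR → A → ℝ) → Fin n → ℝ) : Prop :=
  (∀ k, IsSignal (π k) ∧ IC μ0 (π k) uR) ∧
  IsOptimalRule μ0 uR D ∧
  ∀ (i : Fin n) (π' : Ω i × ΩR → A → ℝ), IsSignal π' → IC μ0 π' uR →
    ∃ D', IsOptimalRule μ0 uR D' ∧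
      payoffUnder μ0 D' (Function.update π i π') i (u i) ≤ payoffUnder μ0 D π i (u i)

/-- Expectations of functions of `(ω_i, ω_R)` are computed from the marginal on that pair. -/
lemma sum_mul_eq_sum_marginal (F : ((∀ k, Ω k) × ΩR) → ℝ) (i : Fin n) (G : Ω i → ΩR → ℝ) :
    ∑ ω, F ω * G (ω.1 i) ω.2 = ∑ x, ∑ y,
      (∑ ω ∈ univ.filter (fun ω : (∀ k, Ω k) × ΩR => ω.1 i = x ∧ ω.2 = y), F ω) * G x y := by
  simp_rw [← Fintype.sum_prod_type', sum_mul, sum_filter]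
  rw [sum_comm]
  refine sum_congr rfl fun ω _ => ?_
  rw [sum_eq_single (ω.1 i, ω.2)]
  · simp
  · rintro ⟨x, y⟩ _ hne
    rw [if_neg]
    rintro ⟨rfl, rfl⟩
    exact hne rfl
  · simp

lemma margR_eq_sum_margIR (μ0 : ((∀ k, Ω k) × ΩR) → ℝ) {k : Fin n}
    (π : Ω k × ΩR → A → ℝ) (i : Fin n) (y : ΩR) (a : A) :
    margR μ0 π y a = ∑ x, margIR μ0 π i x y a := by
  simp only [margR, margIR, sum_filter]
  rw [sum_comm]
  refine sum_congr rfl fun ω _ => ?_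
  rw [sum_eq_single (ω.1 i)]
  · simp
  · intro x _ hne
    rw [if_neg]
    rintro ⟨rfl, -⟩
    exact hne rfl
  · simp

lemma vR_eq_sum_margIR (μ0 : ((∀ k, Ω k) × ΩR) → ℝ) {k : Fin n}
    (π : Ω k × ΩR → A → ℝ) (uR : A → ΩR → ℝ) (i : Fin n) :
    vR μ0 π uR = ∑ x, ∑ y, ∑ a, margIR μ0 π i x y a * uR a y := by
  simp only [vR, margIR]
  simp_rw [fun a => sum_mul_eq_sum_marginal (fun ω => jointP μ0 π ω a) i (fun _ y => uR a y)]
  rw [sum_comm]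
  exact sum_congr rfl fun x _ => sum_comm

lemma vS_eq_sum_margIR (μ0 : ((∀ k, Ω k) × ΩR) → ℝ) {k : Fin n}
    (π : Ω k × ΩR → A → ℝ) (i : Fin n) (ui : A → Ω i → ℝ) :
    vS μ0 π i ui = ∑ x, ∑ y, ∑ a, margIR μ0 π i x y a * ui a x := by
  simp only [vS, margIR]
  simp_rw [fun a => sum_mul_eq_sum_marginal (fun ω => jointP μ0 π ω a) i (fun x _ => ui a x)]
  rw [sum_comm]
  exact sum_congr rfl fun x _ => sum_comm

lemma jointP_nonneg {μ0 : ((∀ k, Ω k) × ΩR) → ℝ} (hμ0 : ∀ ω, 0 ≤ μ0 ω) {k : Fin n}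
    {π : Ω k × ΩR → A → ℝ} (hπ : IsSignal π) (ω : (∀ k, Ω k) × ΩR) (a : A) :
    0 ≤ jointP μ0 π ω a :=
  mul_nonneg (hμ0 ω) (hπ.1 _ a)

lemma margIR_nonneg {μ0 : ((∀ k, Ω k) × ΩR) → ℝ} (hμ0 : ∀ ω, 0 ≤ μ0 ω) {k : Fin n}
    {π : Ω k × ΩR → A → ℝ} (hπ : IsSignal π) (i : Fin n) (x : Ω i) (y : ΩR) (a : A) :
    0 ≤ margIR μ0 π i x y a :=
  sum_nonneg fun ω _ => jointP_nonneg hμ0 hπ ω a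

/-- Incentive compatibility as a family of linear inequalities. -/
lemma IC_iff_sum_margIR {μ0 : ((∀ k, Ω k) × ΩR) → ℝ} (hμ0 : ∀ ω, 0 ≤ μ0 ω) {k : Fin n}
    {π : Ω k × ΩR → A → ℝ} (hπ : IsSignal π) (uR : A → ΩR → ℝ) (i : Fin n) :
    IC μ0 π uR ↔
      ∀ a b, ∑ x, ∑ y, margIR μ0 π i x y a * (uR b y - uR a y) ≤ 0 := by
  refine forall_congr' fun a => ?_
  have key : ∀ b, ∑ x, ∑ y, margIR μ0 π i x y a * (uR b y - uR a y) =
      ∑ ω, jointP μ0 π ω a * uR b ω.2 - ∑ ω, jointP μ0 π ω a * uR a ω.2 := fun b => by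
    rw [← sum_sub_distrib]
    simp_rw [← mul_sub]
    exact (sum_mul_eq_sum_marginal (fun ω => jointP μ0 π ω a) i
      (fun _ y => uR b y - uR a y)).symm
  have hnn : 0 ≤ Pmsg μ0 π a := sum_nonneg fun ω _ => jointP_nonneg hμ0 hπ ω a
  rcases hnn.lt_or_eq with hpos | hzero
  · simp only [hpos, true_imp_iff]
    refine forall_congr' fun b => ?_
    rw [key, sub_nonpos, condExpR, condExpR, div_le_div_iff_of_pos_right hpos]
  · have h0 : ∀ ω, jointP μ0 π ω a = 0 := fun ω =>
      (sum_eq_zero_iff_of_nonneg fun ω _ => jointP_nonneg hμ0 hπ ω a).1 hzero.symm ω (mem_univ ω)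
    simp [← hzero, key, h0]

lemma sum_margIR_eq_marginal (μ0 : ((∀ k, Ω k) × ΩR) → ℝ) {k : Fin n}
    {π : Ω k × ΩR → A → ℝ} (hπ : IsSignal π) (i : Fin n) (x : Ω i) (y : ΩR) :
    ∑ a, margIR μ0 π i x y a =
      ∑ ω ∈ univ.filter (fun ω : (∀ k, Ω k) × ΩR => ω.1 i = x ∧ ω.2 = y), μ0 ω := by
  simp only [margIR, jointP]
  rw [sum_comm]
  simp [← mul_sum, hπ.2]

lemma margIR_self (μ0 : ((∀ k, Ω k) × ΩR) → ℝ) {i : Fin n}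
    (σ : Ω i × ΩR → A → ℝ) (x : Ω i) (y : ΩR) (a : A) :
    margIR μ0 σ i x y a =
      (∑ ω ∈ univ.filter (fun ω : (∀ k, Ω k) × ΩR => ω.1 i = x ∧ ω.2 = y), μ0 ω) *
        σ (x, y) a := by
  rw [margIR, sum_mul]
  refine sum_congr rfl fun ω hω => ?_
  obtain ⟨rfl, rfl⟩ := (mem_filter.1 hω).2
  rfl

open Classical in
/-- Move the fraction `f a` of the mass `p a` from every message `a` to the message `g`. -/
noncomputable def shiftMass (p f : A → ℝ) (g a : A) : ℝ :=
  p a * (1 - f a) + if a = g then ∑ b, p b * f b else 0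

lemma sum_shiftMass_mul (p f : A → ℝ) (g : A) (w : A → ℝ) :
    ∑ a, shiftMass p f g a * w a = ∑ a, p a * w a + ∑ a, p a * f a * (w g - w a) := by
  classical
  simp only [shiftMass, add_mul, ite_mul, zero_mul, sum_add_distrib, sum_ite_eq', mem_univ,
    if_true, sum_mul]
  rw [← sum_add_distrib, ← sum_add_distrib]
  exact sum_congr rfl fun a _ => by ring

lemma sum_shiftMass (p f : A → ℝ) (g : A) : ∑ a, shiftMass p f g a = ∑ a, p a := by
  simpa using sum_shiftMass_mul p f g (fun _ => 1)

lemma shiftMass_nonneg {p f : A → ℝ} (hp : ∀ a, 0 ≤ p a) (hf0 : ∀ a, 0 ≤ f a)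
    (hf1 : ∀ a, f a ≤ 1) (g a : A) : 0 ≤ shiftMass p f g a := by
  unfold shiftMass
  have h1 : 0 ≤ p a * (1 - f a) := mul_nonneg (hp a) (sub_nonneg.2 (hf1 a))
  have h2 : 0 ≤ ∑ b, p b * f b := sum_nonneg fun b _ => mul_nonneg (hp b) (hf0 b)
  split_ifs <;> linarith

/-- Any sender `i` can replicate another signal and shift mass towards the actions `g`. -/
lemma exists_signal_margIR_eq_shiftMass {μ0 : ((∀ k, Ω k) × ΩR) → ℝ} (hμ0 : ∀ ω, 0 ≤ μ0 ω)
    {k : Fin n} {π : Ω k × ΩR → A → ℝ} (hπ : IsSignal π) (i : Fin n) (g : ΩR → A)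
    (f : Ω i → ΩR → A → ℝ) (hf0 : ∀ x y a, 0 ≤ f x y a) (hf1 : ∀ x y a, f x y a ≤ 1) :
    ∃ σ : Ω i × ΩR → A → ℝ, IsSignal σ ∧ ∀ x y a,
      margIR μ0 σ i x y a = shiftMass (margIR μ0 π i x y) (f x y) (g y) a := by
  classical
  have hsh := fun x y => shiftMass_nonneg (margIR_nonneg hμ0 hπ i x y) (hf0 x y) (hf1 x y) (g y)
  let m : Ω i → ΩR → ℝ := fun x y =>
    ∑ ω ∈ univ.filter (fun ω : (∀ k, Ω k) × ΩR => ω.1 i = x ∧ ω.2 = y), μ0 ω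
  have hm : ∀ x y, 0 ≤ m x y := fun x y => sum_nonneg fun ω _ => hμ0 ω
  have hsum : ∀ x y, ∑ a, shiftMass (margIR μ0 π i x y) (f x y) (g y) a = m x y :=
    fun x y => (sum_shiftMass _ _ _).trans (sum_margIR_eq_marginal μ0 hπ i x y)
  refine ⟨fun s a => if m s.1 s.2 = 0 then (if a = g s.2 then 1 else 0) else
    shiftMass (margIR μ0 π i s.1 s.2) (f s.1 s.2) (g s.2) a / m s.1 s.2,
    ⟨fun s a => ?_, fun s => ?_⟩, fun x y a => ?_⟩
  · dsimp only
    split_ifs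
    exacts [zero_le_one, le_rfl, div_nonneg (hsh _ _ _) (hm _ _)]
  · by_cases h : m s.1 s.2 = 0
    · simp [h]
    · simp only [h, if_false]
      rw [← sum_div, hsum, div_self h]
  · rw [margIR_self]
    change m x y * _ = _
    by_cases h : m x y = 0
    · rw [h, zero_mul]
      exact ((sum_eq_zero_iff_of_nonneg fun a _ => hsh x y a).1 ((hsum x y).trans h)
        a (mem_univ a)).symm
    · simp only [h, if_false]
      rw [mul_div_cancel₀ _ h]

/-- If the shifted mass is, for the receiver, the constant fraction `c` of the mass of each pair
of a state and a message, then shifting towards the receiver's best actions keeps incentive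
compatibility and strictly benefits the receiver. -/
lemma exists_better_signal {μ0 : ((∀ k, Ω k) × ΩR) → ℝ} (hμ0 : ∀ ω, 0 ≤ μ0 ω)
    {uR : A → ΩR → ℝ} {k : Fin n} {π : Ω k × ΩR → A → ℝ} (hπ : IsSignal π)
    (hIC : IC μ0 π uR) (i : Fin n) {g : ΩR → A} (hg : ∀ y a, a ≠ g y → uR a y < uR (g y) y)
    (hFI : ∃ a y, 0 < margR μ0 π y a ∧ a ≠ g y)
    {c : ℝ} (hc0 : 0 < c) (hc1 : c ≤ 1) (f : Ω i → ΩR → A → ℝ)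
    (hf0 : ∀ x y a, 0 ≤ f x y a) (hf1 : ∀ x y a, f x y a ≤ 1)
    (hfc : ∀ y a, ∑ x, margIR μ0 π i x y a * f x y a = c * margR μ0 π y a) (ui : A → Ω i → ℝ) :
    ∃ σ : Ω i × ΩR → A → ℝ, IsSignal σ ∧ IC μ0 σ uR ∧ vR μ0 π uR < vR μ0 σ uR ∧
      vS μ0 σ i ui = vS μ0 π i ui +
        ∑ x, ∑ y, ∑ a, margIR μ0 π i x y a * f x y a * (ui (g y) x - ui a x) := by
  classical
  obtain ⟨σ, hσ, hσm⟩ := exists_signal_margIR_eq_shiftMass hμ0 hπ i g f hf0 hf1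
  have hg' : ∀ y a, uR a y ≤ uR (g y) y := fun y a => by
    by_cases h : a = g y
    · rw [h]
    · exact (hg y a h).le
  have hR : ∀ y a, 0 ≤ margR μ0 π y a := fun y a =>
    sum_nonneg fun ω _ => jointP_nonneg hμ0 hπ ω a
  refine ⟨σ, hσ, ?_, ?_, ?_⟩
  · rw [IC_iff_sum_margIR hμ0 hσ uR i]
    intro a b
    have h := (IC_iff_sum_margIR hμ0 hπ uR i).1 hIC a b
    rw [sum_comm] at h ⊢
    simp_rw [← sum_mul, ← margR_eq_sum_margIR] at h
    have hmarg : ∀ y, ∑ x, margIR μ0 σ i x y a = (1 - c) * margR μ0 π y a +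
        if a = g y then c * ∑ b, margR μ0 π y b else 0 := fun y => by
      simp only [hσm, shiftMass, sum_add_distrib, mul_sub, mul_one, sum_sub_distrib, hfc,
        ← margR_eq_sum_margIR]
      split_ifs
      · rw [sum_comm]
        simp_rw [hfc, mul_sum]
        ring
      · simp
        ring
    simp_rw [← sum_mul, hmarg, add_mul, sum_add_distrib, mul_assoc]
    rw [← mul_sum]
    refine add_nonpos (mul_nonpos_of_nonneg_of_nonpos (sub_nonneg.2 hc1) h)
      (sum_nonpos fun y _ => ?_)
    split_ifs with hay
    · subst hay
      exact mul_nonpos_of_nonneg_of_nonpos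
        (mul_nonneg hc0.le (sum_nonneg fun b _ => hR y b)) (sub_nonpos.2 (hg' y b))
    · simp
  · rw [vR_eq_sum_margIR μ0 σ uR i, vR_eq_sum_margIR μ0 π uR i]
    simp_rw [hσm, fun x y => sum_shiftMass_mul (margIR μ0 π i x y) (f x y) (g y)
      (fun a => uR a y), sum_add_distrib]
    rw [lt_add_iff_pos_right, sum_comm]
    simp_rw [fun y => sum_comm (s := (univ : Finset (Ω i))) (t := (univ : Finset A))
      (f := fun x a => margIR μ0 π i x y a * f x y a * (uR (g y) y - uR a y)), ← sum_mul, hfc]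
    have hnn : ∀ y a, 0 ≤ c * margR μ0 π y a * (uR (g y) y - uR a y) := fun y a =>
      mul_nonneg (mul_nonneg hc0.le (hR y a)) (sub_nonneg.2 (hg' y a))
    obtain ⟨a, y, hpos, hay⟩ := hFI
    exact sum_pos' (fun y _ => sum_nonneg fun a _ => hnn y a) ⟨y, mem_univ y,
      sum_pos' (fun a _ => hnn y a) ⟨a, mem_univ a,
        mul_pos (mul_pos hc0 hpos) (sub_pos.2 (hg y a hay))⟩⟩
  · rw [vS_eq_sum_margIR μ0 σ i ui, vS_eq_sum_margIR μ0 π i ui]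
    simp_rw [hσm, fun x y => sum_shiftMass_mul (margIR μ0 π i x y) (f x y) (g y)
      (fun a => ui a x), sum_add_distrib]

/-- A sender can make the receiver strictly better off at an arbitrarily small loss. -/
lemma exists_better_signal_small_loss {μ0 : ((∀ k, Ω k) × ΩR) → ℝ} (hμ0 : ∀ ω, 0 ≤ μ0 ω)
    {uR : A → ΩR → ℝ} {k : Fin n} {π : Ω k × ΩR → A → ℝ} (hπ : IsSignal π)
    (hIC : IC μ0 π uR) (i : Fin n) {g : ΩR → A} (hg : ∀ y a, a ≠ g y → uR a y < uR (g y) y)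
    (hFI : ∃ a y, 0 < margR μ0 π y a ∧ a ≠ g y) (ui : A → Ω i → ℝ) {p : ℝ}
    (hp : p < vS μ0 π i ui) :
    ∃ σ : Ω i × ΩR → A → ℝ, IsSignal σ ∧ IC μ0 σ uR ∧ vR μ0 π uR < vR μ0 σ uR ∧
      p < vS μ0 σ i ui := by
  set T := ∑ x, ∑ y, ∑ a, margIR μ0 π i x y a * (ui (g y) x - ui a x) with hT
  obtain ⟨c, hc0, hc1, hcT⟩ : ∃ c : ℝ, 0 < c ∧ c ≤ 1 ∧ p < vS μ0 π i ui + c * T := by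
    have hlim : Filter.Tendsto (fun c : ℝ => vS μ0 π i ui + c * T) (nhdsWithin 0 (Set.Ioi 0))
        (nhds (vS μ0 π i ui)) := by
      have : Continuous fun c : ℝ => vS μ0 π i ui + c * T := by fun_prop
      simpa using (this.tendsto 0).mono_left nhdsWithin_le_nhds
    obtain ⟨c, hcp, hc⟩ := ((hlim.eventually_const_lt hp).and
      (Ioc_mem_nhdsGT (zero_lt_one' ℝ))).exists
    exact ⟨c, hc.1, hc.2, hcp⟩
  obtain ⟨σ, hσ, hσIC, hlt, hval⟩ := exists_better_signal hμ0 hπ hIC i hg hFI hc0 hc1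
    (fun _ _ _ => c) (fun _ _ _ => hc0.le) (fun _ _ _ => hc1)
    (fun y a => by rw [← sum_mul, ← margR_eq_sum_margIR, mul_comm]) ui
  refine ⟨σ, hσ, hσIC, hlt, ?_⟩
  rw [hval]
  convert hcT using 2
  rw [hT]
  simp_rw [mul_sum]
  exact sum_congr rfl fun x _ => sum_congr rfl fun y _ => sum_congr rfl fun a _ => by ring

lemma exists_pos_forall_mul_le {ι : Type*} [Finite ι] (r h : ι → ℝ) (hh : ∀ x, 0 ≤ h x)
    (hr : ∀ x, 0 < r x → 0 < h x) : ∃ c : ℝ, 0 < c ∧ c ≤ 1 ∧ ∀ x, c * r x ≤ h x := by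
  have hev : ∀ᶠ c : ℝ in nhdsWithin 0 (Set.Ioi 0), ∀ x, c * r x ≤ h x := by
    rw [Filter.eventually_all]
    intro x
    by_cases hx : 0 < r x
    · have hcont : Continuous fun c : ℝ => c * r x := by fun_prop
      have hlim : Filter.Tendsto (fun c : ℝ => c * r x) (nhdsWithin 0 (Set.Ioi 0)) (nhds 0) := by
        simpa using (hcont.tendsto 0).mono_left nhdsWithin_le_nhds
      exact (hlim.eventually_lt_const (hr x hx)).mono fun c hc => hc.le
    · filter_upwards [self_mem_nhdsWithin] with c hc
      exact (mul_nonpos_of_nonneg_of_nonpos (le_of_lt hc) (not_lt.1 hx)).trans (hh x)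
  obtain ⟨c, hcx, hc⟩ := (hev.and (Ioc_mem_nhdsGT (zero_lt_one' ℝ))).exists
  exact ⟨c, hc.1, hc.2, hcx⟩

lemma lt_of_argmaxSet_eq_singleton {v : A → ℝ} {g : A} (hg : argmaxSet v = {g}) {a : A}
    (ha : a ≠ g) : v a < v g := by
  have hmax : ∀ b, v b ≤ v g := by
    have : g ∈ argmaxSet v := by simp [hg]
    simpa [argmaxSet] using this
  refine lt_of_le_of_ne (hmax a) fun heq => ha ?_
  have : a ∈ argmaxSet v := by simpa [argmaxSet, heq] using hmax
  simpa [hg] using this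

/-- Under Assumption 2, whenever a message of sender `k` has positive probability together with
a receiver state, so does some state of sender `i` whose best action is the receiver's. -/
lemma exists_aligned_margIR_pos {μ0 : ((∀ k, Ω k) × ΩR) → ℝ} (hμ0 : ∀ ω, 0 ≤ μ0 ω)
    {uR : A → ΩR → ℝ} {u : ∀ k : Fin n, A → Ω k → ℝ} (hA2 : Assumption2 μ0 uR u)
    {k i : Fin n} (hik : i ≠ k) {π : Ω k × ΩR → A → ℝ} (hπ : IsSignal π)
    {y : ΩR} {a : A} (hpos : 0 < margR μ0 π y a) :
    ∃ x : Ω i, argmaxSet (fun b => u i b x) = argmaxSet (fun b => uR b y) ∧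
      0 < margIR μ0 π i x y a := by
  obtain ⟨ω, hω, hωpos⟩ := exists_lt_of_sum_lt (f := fun _ => (0 : ℝ)) (by simpa [margR] using hpos)
  obtain rfl : ω.2 = y := (mem_filter.1 hω).2
  have hμpos : 0 < μ0 ω := pos_of_mul_pos_left hωpos (hπ.1 _ _)
  have hπpos : 0 < π (ω.1 k, ω.2) a := pos_of_mul_pos_right hωpos (hμ0 _)
  obtain ⟨x, hx, hxal⟩ := hA2 i k hik (ω.1 k) ω.2
    (sum_pos' (fun ω _ => hμ0 ω) ⟨ω, by simp, hμpos⟩)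
  obtain ⟨ω', hω', hω'pos⟩ := exists_lt_of_sum_lt (f := fun _ => (0 : ℝ)) (by simpa using hx)
  obtain ⟨h1, h2, h3⟩ := (mem_filter.1 hω').2
  refine ⟨x, hxal, sum_pos' (fun ω _ => jointP_nonneg hμ0 hπ ω a) ⟨ω', by simp [h1, h3], ?_⟩⟩
  rw [jointP, h2, h3]
  exact mul_pos hω'pos hπpos

/-- Sender `i` can improve on another sender's signal for himself and for the receiver. -/
lemma exists_better_signal_of_ne {μ0 : ((∀ k, Ω k) × ΩR) → ℝ} (hμ0 : ∀ ω, 0 ≤ μ0 ω)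
    {uR : A → ΩR → ℝ} {u : ∀ k : Fin n, A → Ω k → ℝ} (hA2 : Assumption2 μ0 uR u)
    {k i : Fin n} (hik : i ≠ k) {π : Ω k × ΩR → A → ℝ} (hπ : IsSignal π)
    (hIC : IC μ0 π uR) {g : ΩR → A} (hg : ∀ y, argmaxSet (fun a => uR a y) = {g y})
    (hFI : ∃ a y, 0 < margR μ0 π y a ∧ a ≠ g y) :
    ∃ σ : Ω i × ΩR → A → ℝ, IsSignal σ ∧ IC μ0 σ uR ∧ vR μ0 π uR < vR μ0 σ uR ∧
      vS μ0 π i (u i) < vS μ0 σ i (u i) := by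
  classical
  let al : Ω i → ΩR → Prop := fun x y =>
    argmaxSet (fun b => u i b x) = argmaxSet (fun b => uR b y)
  let h : ΩR → A → ℝ := fun y a => ∑ x, if al x y then margIR μ0 π i x y a else 0
  have hq := margIR_nonneg hμ0 hπ i
  have hR : ∀ y a, 0 ≤ margR μ0 π y a := fun y a =>
    sum_nonneg fun ω _ => jointP_nonneg hμ0 hπ ω a
  have hterm : ∀ y a x, 0 ≤ if al x y then margIR μ0 π i x y a else 0 := fun y a x => by
    split_ifs
    exacts [hq x y a, le_rfl]
  have hh : ∀ y a, 0 ≤ h y a := fun y a => sum_nonneg fun x _ => hterm y a x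
  have hpos : ∀ y a, 0 < margR μ0 π y a → 0 < h y a := fun y a hy => by
    obtain ⟨x, hx, hxpos⟩ := exists_aligned_margIR_pos hμ0 hA2 hik hπ hy
    exact sum_pos' (fun x _ => hterm y a x) ⟨x, mem_univ x, by rwa [if_pos hx]⟩
  obtain ⟨c, hc0, hc1, hc⟩ := exists_pos_forall_mul_le (fun s : ΩR × A => margR μ0 π s.1 s.2)
    (fun s => h s.1 s.2) (fun s => hh _ _) (fun s => hpos _ _)
  let f : Ω i → ΩR → A → ℝ := fun x y a => if al x y then c * margR μ0 π y a / h y a else 0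
  have hf0 : ∀ x y a, 0 ≤ f x y a := fun x y a => by
    dsimp only [f]
    split_ifs
    exacts [div_nonneg (mul_nonneg hc0.le (hR y a)) (hh y a), le_rfl]
  have hf1 : ∀ x y a, f x y a ≤ 1 := fun x y a => by
    dsimp only [f]
    split_ifs
    exacts [div_le_one_of_le₀ (hc (y, a)) (hh y a), zero_le_one]
  have hfc : ∀ y a, ∑ x, margIR μ0 π i x y a * f x y a = c * margR μ0 π y a := fun y a => by
    have : ∑ x, margIR μ0 π i x y a * f x y a = h y a * (c * margR μ0 π y a / h y a) := by
      simp only [f, h, sum_mul, mul_ite, ite_mul, mul_zero, zero_mul]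
    rw [this]
    by_cases hy : 0 < margR μ0 π y a
    · exact mul_div_cancel₀ _ (hpos y a hy).ne'
    · simp [le_antisymm (not_lt.1 hy) (hR y a)]
  obtain ⟨σ, hσ, hσIC, hlt, hval⟩ := exists_better_signal hμ0 hπ hIC i
    (fun y a ha => lt_of_argmaxSet_eq_singleton (hg y) ha) hFI hc0 hc1 f hf0 hf1 hfc (u i)
  refine ⟨σ, hσ, hσIC, hlt, ?_⟩
  rw [hval, lt_add_iff_pos_right]
  have hgain : ∀ x y a, al x y → a ≠ g y → u i a x < u i (g y) x := fun x y a hal ha =>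
    lt_of_argmaxSet_eq_singleton (v := fun b => u i b x) (hal.trans (hg y)) ha
  have hnn : ∀ x y a, 0 ≤ margIR μ0 π i x y a * f x y a * (u i (g y) x - u i a x) := by
    intro x y a
    by_cases hal : al x y
    · refine mul_nonneg (mul_nonneg (hq x y a) (hf0 x y a)) (sub_nonneg.2 ?_)
      by_cases ha : a = g y
      · rw [ha]
      · exact (hgain x y a hal ha).le
    · simp [f, hal]
  obtain ⟨a, y, hya, ha⟩ := hFI
  obtain ⟨x, hx, hxpos⟩ := exists_aligned_margIR_pos hμ0 hA2 hik hπ hya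
  have hfx : 0 < f x y a := by
    dsimp only [f]
    rw [if_pos hx]
    exact div_pos (mul_pos hc0 hya) (hpos y a hya)
  exact sum_pos' (fun x _ => sum_nonneg fun y _ => sum_nonneg fun a _ => hnn x y a)
    ⟨x, mem_univ x, sum_pos' (fun y _ => sum_nonneg fun a _ => hnn x y a)
      ⟨y, mem_univ y, sum_pos' (fun a _ => hnn x y a) ⟨a, mem_univ a,
        mul_pos (mul_pos hxpos hfx) (sub_pos.2 (hgain x y a hx ha))⟩⟩⟩

lemma vR_eq_sum_margR (μ0 : ((∀ k, Ω k) × ΩR) → ℝ) {k : Fin n}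
    (π : Ω k × ΩR → A → ℝ) (uR : A → ΩR → ℝ) :
    vR μ0 π uR = ∑ y, ∑ a, margR μ0 π y a * uR a y := by
  rw [vR_eq_sum_margIR μ0 π uR k, sum_comm]
  refine sum_congr rfl fun y _ => ?_
  rw [sum_comm]
  simp_rw [margR_eq_sum_margIR μ0 π k, sum_mul]

lemma sum_margR_eq_marginal (μ0 : ((∀ k, Ω k) × ΩR) → ℝ) {k : Fin n}
    {π : Ω k × ΩR → A → ℝ} (hπ : IsSignal π) (y : ΩR) :
    ∑ a, margR μ0 π y a =
      ∑ ω ∈ univ.filter (fun ω : (∀ k, Ω k) × ΩR => ω.2 = y), μ0 ω := by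
  simp only [margR, jointP]
  rw [sum_comm]
  simp [← mul_sum, hπ.2]

/-- A signal that is as good for the receiver as one with a suboptimal message is itself one with
a suboptimal message. -/
lemma exists_suboptimal_of_vR_le {μ0 : ((∀ k, Ω k) × ΩR) → ℝ} (hμ0 : ∀ ω, 0 ≤ μ0 ω)
    {uR : A → ΩR → ℝ} {k l : Fin n} {π : Ω k × ΩR → A → ℝ} (hπ : IsSignal π)
    {ρ : Ω l × ΩR → A → ℝ} (hρ : IsSignal ρ) {g : ΩR → A}
    (hg : ∀ y a, a ≠ g y → uR a y < uR (g y) y)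
    (hFI : ∃ a y, 0 < margR μ0 π y a ∧ a ≠ g y) (hle : vR μ0 ρ uR ≤ vR μ0 π uR) :
    ∃ a y, 0 < margR μ0 ρ y a ∧ a ≠ g y := by
  by_contra! hcon
  have hRπ : ∀ y a, 0 ≤ margR μ0 π y a := fun y a =>
    sum_nonneg fun ω _ => jointP_nonneg hμ0 hπ ω a
  have hRρ : ∀ y a, 0 ≤ margR μ0 ρ y a := fun y a =>
    sum_nonneg fun ω _ => jointP_nonneg hμ0 hρ ω a
  have hρv : vR μ0 ρ uR = ∑ y, ∑ a, margR μ0 π y a * uR (g y) y := by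
    rw [vR_eq_sum_margR]
    refine sum_congr rfl fun y _ => ?_
    rw [← sum_mul, sum_margR_eq_marginal μ0 hπ, ← sum_margR_eq_marginal μ0 hρ, sum_mul]
    refine sum_congr rfl fun a _ => ?_
    rcases (hRρ y a).lt_or_eq with h | h
    · rw [← hcon a y h]
    · simp [← h]
  obtain ⟨a, y, hpos, ha⟩ := hFI
  have hterm : ∀ y a, margR μ0 π y a * uR a y ≤ margR μ0 π y a * uR (g y) y := fun y a => by
    by_cases h : a = g y
    · rw [h]
    · exact mul_le_mul_of_nonneg_left (hg y a h).le (hRπ y a)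
  refine hle.not_gt ?_
  rw [hρv, vR_eq_sum_margR]
  exact sum_lt_sum (fun y _ => sum_le_sum fun a _ => hterm y a) ⟨y, mem_univ y,
    sum_lt_sum (fun a _ => hterm y a) ⟨a, mem_univ a, mul_lt_mul_of_pos_left (hg y a ha) hpos⟩⟩

/-- In a pessimistic equilibrium, no sender has a signal that the receiver strictly prefers to
all equilibrium signals and that yields him more than his equilibrium payoff. -/
lemma PessimisticNE.vS_le_payoffUnder {μ0 : ((∀ k, Ω k) × ΩR) → ℝ}
    {π : ∀ k : Fin n, Ω k × ΩR → A → ℝ} {uR : A → ΩR → ℝ} {u : ∀ k : Fin n, A → Ω k → ℝ}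
    {D : (∀ k : Fin n, Ω k × ΩR → A → ℝ) → Fin n → ℝ} (hNE : PessimisticNE μ0 π uR u D)
    {i : Fin n} {σ : Ω i × ΩR → A → ℝ} (hσ : IsSignal σ) (hIC : IC μ0 σ uR)
    (hlt : ∀ k, vR μ0 (π k) uR < vR μ0 σ uR) :
    vS μ0 σ i (u i) ≤ payoffUnder μ0 D π i (u i) := by
  obtain ⟨D', hD', hle⟩ := hNE.2.2 i σ hσ hIC
  obtain ⟨hnn, hsum, hopt⟩ := hD' (Function.update π i σ) fun k => by
    rcases eq_or_ne k i with rfl | hk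
    · simpa using ⟨hσ, hIC⟩
    · simpa [hk] using hNE.1 k
  have hzero : ∀ k, k ≠ i → D' (Function.update π i σ) k = 0 := fun k hk => by
    refine le_antisymm (not_lt.1 fun hpos => ?_) (hnn k)
    have := hopt k hpos i
    rw [Function.update_self, Function.update_of_ne hk] at this
    exact this.not_gt (hlt k)
  rw [Fintype.sum_eq_single i hzero] at hsum
  rw [payoffUnder, Fintype.sum_eq_single i fun k hk => by rw [hzero k hk, zero_mul], hsum,
    one_mul, Function.update_self] at hle
  exact hle

/-- Appendix: with at least two senders and under Assumptions 1 and 2, every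
pure pessimistic Nash equilibrium `((π_1,…,π_n), D)` is fully informative: every sender
chosen by `D` with positive probability plays a fully informative signal. -/
theorem pessimistic_NE_fully_informative
    [Nonempty A] [Nonempty ΩR] [∀ k, Nonempty (Ω k)]
    (hn : 2 ≤ n)
    (μ0 : ((∀ k, Ω k) × ΩR) → ℝ)
    (hμ0 : ∀ ω, 0 ≤ μ0 ω) (hμ1 : ∑ ω, μ0 ω = 1)
    (uR : A → ΩR → ℝ) (u : ∀ k : Fin n, A → Ω k → ℝ)
    (hA1 : Assumption1 uR u) (hA2 : Assumption2 μ0 uR u)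
    (π : ∀ k : Fin n, Ω k × ΩR → A → ℝ)
    (D : (∀ k : Fin n, Ω k × ΩR → A → ℝ) → Fin n → ℝ)
    (hNE : PessimisticNE μ0 π uR u D) :
    ∀ j : Fin n, 0 < D π j → FullyInformative μ0 (π j) uR := by
  classical
  intro j hj
  obtain ⟨hDnn, hDsum, hDopt⟩ := hNE.2.1 π hNE.1
  choose g hg using fun y => card_eq_one.1 (hA1.1 y)
  have hg' : ∀ y a, a ≠ g y → uR a y < uR (g y) y := fun y a ha =>
    lt_of_argmaxSet_eq_singleton (hg y) ha
  by_contra hnot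
  have hFIj : ∃ a y, 0 < margR μ0 (π j) y a ∧ a ≠ g y := by
    simp only [FullyInformative, hg, not_forall] at hnot
    obtain ⟨a, y, hpos, hne⟩ := hnot
    exact ⟨a, y, hpos, fun h => hne (by rw [h])⟩
  have hFI : ∀ k, ∃ a y, 0 < margR μ0 (π k) y a ∧ a ≠ g y := fun k =>
    exists_suboptimal_of_vR_le hμ0 (hNE.1 j).1 (hNE.1 k).1 hg' hFIj (hDopt j hj k)
  have : Nontrivial (Fin n) := Fin.nontrivial_iff_two_le.2 hn
  obtain ⟨i, hij⟩ := exists_ne j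
  have hbelow : ∀ k, k ≠ i → 0 < D π k → vS μ0 (π k) i (u i) < payoffUnder μ0 D π i (u i) := by
    intro k hki hk
    obtain ⟨σ, hσ, hIC, hlt, hgt⟩ := exists_better_signal_of_ne hμ0 hA2 hki.symm
      (hNE.1 k).1 (hNE.1 k).2 hg (hFI k)
    exact hgt.trans_le (hNE.vS_le_payoffUnder hσ hIC fun l => (hDopt k hk l).trans_lt hlt)
  have hown : 0 < D π i → vS μ0 (π i) i (u i) ≤ payoffUnder μ0 D π i (u i) := by
    intro hi
    by_contra! hp
    obtain ⟨σ, hσ, hIC, hlt, hgt⟩ := exists_better_signal_small_loss hμ0 (hNE.1 i).1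
      (hNE.1 i).2 i hg' (hFI i) (u i) hp
    exact hgt.not_ge (hNE.vS_le_payoffUnder hσ hIC fun l => (hDopt i hi l).trans_lt hlt)
  have hle : ∀ k, D π k * vS μ0 (π k) i (u i) ≤ D π k * payoffUnder μ0 D π i (u i) := by
    intro k
    rcases (hDnn k).lt_or_eq with hk | hk
    · refine mul_le_mul_of_nonneg_left ?_ hk.le
      rcases eq_or_ne k i with rfl | hki
      exacts [hown hk, (hbelow k hki hk).le]
    · simp [← hk]
  have hlt : payoffUnder μ0 D π i (u i) < ∑ k, D π k * payoffUnder μ0 D π i (u i) :=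
    sum_lt_sum (fun k _ => hle k) ⟨j, mem_univ j, mul_lt_mul_of_pos_left (hbelow j hij.symm hj) hj⟩
  rw [← sum_mul, hDsum, one_mul] at hlt
  exact hlt.false

end Persuasion
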